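/- For every fixed k ∈ ℕ, the number of sparse grid points N(d+k,d) := #H(d+k,d) satisfies the asymptotics lim_{d→∞} N(d+k,d) · k! / (2^k · d^k) = 1. -/

import Mathlib

noncomputable section

/-- The doubling rule: `m 1 = 1` and `m i = 2^{i−1} + 1` for `i ≥ 2`
(and `m 0 = 0` by convention). -/
def mCard (i : ℕ) : ℕ := if i ≤ 1 then i else 2 ^ (i - 1) + 1

/-- The Chebyshev–Gauss–Lobatto node set `X_i ⊆ [0,1]` as a finite set:
`X_1 = {1/2}` and, for `i ≥ 2`,
`X_i = {1/2 − (1/2)·cos((j−1)π/(m_i−1)) : j = 1,…,m_i}`. -/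
def chebFinset (i : ℕ) : Finset ℝ :=
  if i = 1 then {(1 : ℝ) / 2}
  else (Finset.Icc 1 (mCard i)).image
    (fun j : ℕ => 1 / 2 - (1 / 2) * Real.cos (((j : ℝ) - 1) * Real.pi / ((mCard i : ℝ) - 1)))

/-- The sparse grid `H(q,d)` as a finite subset of `[0,1]^d`. -/
def sparseGrid (q d : ℕ) : Finset (Fin d → ℝ) :=
  ((Fintype.piFinset fun _ : Fin d => Finset.Icc 1 q).filter
    (fun ι => q - d + 1 ≤ ∑ k, ι k ∧ ∑ k, ι k ≤ q)).biUnion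
    (fun ι => Fintype.piFinset fun k => chebFinset (ι k))

/-- `N(q,d)`, the number of sparse grid points. -/
def Npts (q d : ℕ) : ℕ := (sparseGrid q d).card

open Finset Filter Topology

/-- The points of `ℝ^d` with exactly `k` marked coordinates, which take their values in `T`, while
all other coordinates equal `1/2`. -/
def gridLayer (T : Finset ℝ) (k d : ℕ) : Finset (Fin d → ℝ) :=
  (powersetCard k univ).biUnion fun s => Fintype.piFinset fun i => if i ∈ s then T else {1 / 2}

lemma mem_gridLayer {T : Finset ℝ} {k d : ℕ} {x : Fin d → ℝ} :
    x ∈ gridLayer T k d ↔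
      ∃ s : Finset (Fin d), #s = k ∧ (∀ i ∈ s, x i ∈ T) ∧ ∀ i ∉ s, x i = 1 / 2 := by
  simp only [gridLayer, mem_biUnion, mem_powersetCard, subset_univ, true_and,
    Fintype.mem_piFinset]
  refine exists_congr fun s => and_congr_right fun _ => ⟨fun h => ⟨fun i hi => ?_, fun i hi => ?_⟩,
    fun h i => ?_⟩
  · simpa [hi] using h i
  · simpa [hi] using h i
  · by_cases hi : i ∈ s
    · simpa [hi] using h.1 i hi
    · simpa [hi] using h.2 i hi

lemma card_piFinset_marked (T : Finset ℝ) {d : ℕ} (s : Finset (Fin d)) :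
    #(Fintype.piFinset fun i => if i ∈ s then T else {1 / 2}) = #T ^ #s := by
  simp [Fintype.card_piFinset, apply_ite Finset.card]

lemma card_gridLayer_le (T : Finset ℝ) (k d : ℕ) :
    #(gridLayer T k d) ≤ d.choose k * #T ^ k := by
  calc #(gridLayer T k d)
    _ ≤ #(powersetCard k (univ : Finset (Fin d))) * #T ^ k :=
      card_biUnion_le_card_mul _ _ _ fun s hs => by
        rw [card_piFinset_marked, (mem_powersetCard.1 hs).2]
    _ = d.choose k * #T ^ k := by simp

lemma card_gridLayer {T : Finset ℝ} (hT : 1 / 2 ∉ T) (k d : ℕ) :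
    #(gridLayer T k d) = d.choose k * #T ^ k := by
  rw [gridLayer, card_biUnion]
  · rw [sum_congr rfl fun s hs => by rw [card_piFinset_marked, (mem_powersetCard.1 hs).2]]
    simp
  · intro s _ t _ hst
    refine disjoint_left.2 fun x hs ht => hst ?_
    rw [Fintype.mem_piFinset] at hs ht
    ext i
    have hsi := hs i
    have hti := ht i
    by_cases his : i ∈ s <;> by_cases hit : i ∈ t <;> simp only [his, hit, if_true, if_false,
      mem_singleton] at hsi hti ⊢
    · exact (hT (hti ▸ hsi)).elim
    · exact (hT (hsi ▸ hti)).elim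

lemma chebFinset_one : chebFinset 1 = {1 / 2} := if_pos rfl

lemma chebFinset_two : chebFinset 2 = {0, 1 / 2, 1} := by
  have h : Icc 1 (mCard 2) = {1, 2, 3} := by decide
  have hm : mCard 2 = 3 := rfl
  rw [chebFinset, if_neg (by decide), h, hm]
  have h1 : ((2 : ℝ) - 1) * Real.pi / (3 - 1) = Real.pi / 2 := by ring
  have h2 : ((3 : ℝ) - 1) * Real.pi / (3 - 1) = Real.pi := by ring
  simp only [image_insert, image_singleton, Nat.cast_one, Nat.cast_ofNat, h1, h2]
  norm_num

lemma mem_sparseGrid {q d : ℕ} {x : Fin d → ℝ} :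
    x ∈ sparseGrid q d ↔ ∃ ι : Fin d → ℕ, (∀ i, 1 ≤ ι i ∧ ι i ≤ q) ∧
      (q - d + 1 ≤ ∑ i, ι i ∧ ∑ i, ι i ≤ q) ∧ ∀ i, x i ∈ chebFinset (ι i) := by
  simp only [sparseGrid, mem_biUnion, mem_filter, Fintype.mem_piFinset, mem_Icc, and_assoc]

lemma gridLayer_subset_sparseGrid (k : ℕ) {d : ℕ} (hd : 1 ≤ d) :
    gridLayer {0, 1} k d ⊆ sparseGrid (d + k) d := by
  intro x hx
  obtain ⟨s, hs, hxs, hxs'⟩ := mem_gridLayer.1 hx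
  have hsum : ∑ i, (1 + if i ∈ s then 1 else 0) = d + k := by
    simp [sum_add_distrib, hs]
  refine mem_sparseGrid.2 ⟨fun i => 1 + if i ∈ s then 1 else 0, fun i => ⟨Nat.le_add_right _ _, ?_⟩,
    ⟨by rw [hsum]; omega, hsum.le⟩, fun i => ?_⟩
  · rw [← hsum]
    exact single_le_sum (f := fun i => 1 + if i ∈ s then 1 else 0) (fun _ _ => Nat.zero_le _)
      (mem_univ i)
  · by_cases hi : i ∈ s
    · have := hxs i hi
      simp only [mem_insert, mem_singleton] at this
      simp only [hi, if_true, Nat.reduceAdd, chebFinset_two, mem_insert, mem_singleton]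
      tauto
    · simpa [hi, chebFinset_one] using hxs' i hi

lemma sparseGrid_subset (k d : ℕ) :
    sparseGrid (d + k) d ⊆ gridLayer {0, 1} k d ∪
      (range k).biUnion fun j => gridLayer ((range (k + 2)).biUnion chebFinset) j d := by
  intro x hx
  obtain ⟨ι, hι, ⟨-, hsum⟩, hxι⟩ := mem_sparseGrid.1 hx
  set s : Finset (Fin d) := {i | x i ≠ 1 / 2} with hs
  have hs' : ∀ i ∉ s, x i = 1 / 2 := fun i hi => by simpa [hs] using hi
  have two_le : ∀ i ∈ s, 2 ≤ ι i := by
    intro i hi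
    by_contra! h
    have h1 : ι i = 1 := by have := (hι i).1; omega
    have := hxι i
    rw [h1, chebFinset_one, mem_singleton] at this
    simp [hs, this] at hi
  have excess : ∑ i, (ι i - 1) ≤ k := by
    have : ∑ i, ι i = ∑ i, (ι i - 1) + d := by
      rw [← sum_congr rfl fun i _ => Nat.sub_add_cancel (hι i).1, sum_add_distrib]
      simp
    omega
  have excess_s : ∑ i ∈ s, (ι i - 1) ≤ k :=
    (sum_le_sum_of_subset (subset_univ s)).trans excess
  have card_le : #s ≤ ∑ i ∈ s, (ι i - 1) := by
    rw [card_eq_sum_ones]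
    exact sum_le_sum fun i hi => by have := two_le i hi; omega
  rcases (card_le.trans excess_s).lt_or_eq with hlt | heq
  · refine mem_union_right _ (mem_biUnion.2 ⟨#s, mem_range.2 hlt,
      mem_gridLayer.2 ⟨s, rfl, fun i _ => mem_biUnion.2 ⟨ι i, mem_range.2 ?_, hxι i⟩, hs'⟩⟩)
    have := (single_le_sum (f := fun i => ι i - 1) (fun _ _ => Nat.zero_le _)
      (mem_univ i)).trans excess
    omega
  · refine mem_union_left _ (mem_gridLayer.2 ⟨s, heq, fun i hi => ?_, hs'⟩)
    have hall : ∑ i ∈ s, 1 = ∑ i ∈ s, (ι i - 1) := by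
      rw [← card_eq_sum_ones]; omega
    have h2 := (sum_eq_sum_iff_of_le fun i hi => by have := two_le i hi; omega).1 hall i hi
    have hι2 : ι i = 2 := by omega
    have hxi := hxι i
    rw [hι2, chebFinset_two] at hxi
    have hne : x i ≠ 1 / 2 := by simpa [hs] using hi
    simp only [mem_insert, mem_singleton] at hxi ⊢
    tauto

lemma le_Npts (k : ℕ) {d : ℕ} (hd : 1 ≤ d) : d.choose k * 2 ^ k ≤ Npts (d + k) d := by
  have h := card_le_card (gridLayer_subset_sparseGrid k hd)
  rwa [card_gridLayer (by norm_num), card_pair zero_ne_one] at h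

lemma Npts_le (k d : ℕ) :
    Npts (d + k) d ≤ d.choose k * 2 ^ k +
      ∑ j ∈ range k, d.choose j * #((range (k + 2)).biUnion chebFinset) ^ j := by
  refine (card_le_card (sparseGrid_subset k d)).trans ((card_union_le _ _).trans ?_)
  refine add_le_add ?_ (card_biUnion_le.trans (sum_le_sum fun j _ => card_gridLayer_le _ _ _))
  exact (card_gridLayer_le _ _ _).trans_eq (by rw [card_pair zero_ne_one])

lemma tendsto_choose_div_pow (k : ℕ) :
    Tendsto (fun d : ℕ => (d.choose k : ℝ) / (d : ℝ) ^ k) atTop (𝓝 (1 / (k.factorial : ℝ))) := by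
  have h : Tendsto (fun d : ℕ => (d.descFactorial k : ℝ) / (d : ℝ) ^ k) atTop (𝓝 1) :=
    (Asymptotics.isEquivalent_iff_tendsto_one
      ((eventually_ne_atTop 0).mono fun d hd => by positivity)).1
      (isEquivalent_descFactorial k)
  refine (h.div_const (k.factorial : ℝ)).congr fun d => ?_
  rw [Nat.descFactorial_eq_factorial_mul_choose, Nat.cast_mul]
  field_simp

lemma tendsto_choose_div_pow_of_lt {j k : ℕ} (hjk : j < k) :
    Tendsto (fun d : ℕ => (d.choose j : ℝ) / (d : ℝ) ^ k) atTop (𝓝 0) := by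
  have hpow : Tendsto (fun d : ℕ => ((d : ℝ) ^ (k - j))⁻¹) atTop (𝓝 0) :=
    ((tendsto_pow_atTop (by omega)).comp tendsto_natCast_atTop_atTop).inv_tendsto_atTop
  have h := (tendsto_choose_div_pow j).mul hpow
  rw [mul_zero] at h
  refine h.congr fun d => ?_
  rw [← div_eq_mul_inv, div_div, ← pow_add, Nat.add_sub_cancel' hjk.le]

/-- for every fixed `k`, `N(d+k,d) ≈ 2^k d^k / k!` as `d → ∞`, i.e.
`N(d+k,d)·k!/(2^k·d^k) → 1`. -/
theorem sparse_grid_cardinality_asymptotics (k : ℕ) :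
    Filter.Tendsto
      (fun d : ℕ => (Npts (d + k) d : ℝ) * (Nat.factorial k : ℝ) / (2 ^ k * (d : ℝ) ^ k))
      Filter.atTop (nhds 1) := by
  set M : ℕ := #((range (k + 2)).biUnion chebFinset)
  have hk : (k.factorial : ℝ) ≠ 0 := by positivity
  have lower : Tendsto (fun d : ℕ => (d.choose k : ℝ) / (d : ℝ) ^ k * (k.factorial : ℝ))
      atTop (𝓝 1) := by
    simpa [hk] using (tendsto_choose_div_pow k).mul_const (k.factorial : ℝ)
  have rest : Tendsto (fun d : ℕ => (∑ j ∈ range k, (d.choose j : ℝ) / (d : ℝ) ^ k * (M : ℝ) ^ j) *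
      ((k.factorial : ℝ) / 2 ^ k)) atTop (𝓝 0) := by
    have := (tendsto_finsetSum (range k) fun j hj =>
      (tendsto_choose_div_pow_of_lt (mem_range.1 hj)).mul_const ((M : ℝ) ^ j)).mul_const
        ((k.factorial : ℝ) / 2 ^ k)
    simpa using this
  have upper := lower.add rest
  rw [add_zero] at upper
  refine tendsto_of_tendsto_of_tendsto_of_le_of_le' lower upper ?_ ?_
  · filter_upwards [eventually_ge_atTop 1] with d hd
    have hd0 : (0 : ℝ) < d := by exact_mod_cast hd
    have h : (d.choose k : ℝ) * 2 ^ k ≤ Npts (d + k) d := by exact_mod_cast le_Npts k hd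
    calc (d.choose k : ℝ) / (d : ℝ) ^ k * (k.factorial : ℝ)
      _ = (d.choose k : ℝ) * 2 ^ k * (k.factorial : ℝ) / (2 ^ k * (d : ℝ) ^ k) := by field_simp
      _ ≤ _ := by gcongr
  · filter_upwards [eventually_ge_atTop 1] with d hd
    have hd0 : (0 : ℝ) < d := by exact_mod_cast hd
    have h : (Npts (d + k) d : ℝ) ≤ d.choose k * 2 ^ k +
        ∑ j ∈ range k, (d.choose j : ℝ) * (M : ℝ) ^ j := by exact_mod_cast Npts_le k d
    calc (Npts (d + k) d : ℝ) * (k.factorial : ℝ) / (2 ^ k * (d : ℝ) ^ k)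
      _ ≤ (d.choose k * 2 ^ k + ∑ j ∈ range k, (d.choose j : ℝ) * (M : ℝ) ^ j) *
          (k.factorial : ℝ) / (2 ^ k * (d : ℝ) ^ k) := by gcongr
      _ = _ := by
        simp only [div_mul_eq_mul_div _ _ ((M : ℝ) ^ _), ← sum_div]
        field_simp
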